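/- With the explicit 6×6 complex matrices X, Y, E₀,…,E₄ defined in the context, let V be the ℂ-linear span of {E₀, E₁, E₂, E₃, E₄}. If W is a ℂ-linear subspace of V such that ⁅X, w⁆ ∈ W and ⁅Y, w⁆ ∈ W for all w ∈ W, then W = 0 or W = V. (This is the statement that the only subspaces of the off-diagonal part invariant under the adjoint action of the sl₂-part are trivial, which forces the Galois group of the third variational equation of Painlevé II to be either 3- or 8-dimensional.) -/

import Mathlib

noncomputable def Xm : Matrix (Fin 6) (Fin 6) ℂ :=
  !![0,1,0,0,0,0; 0,0,2,0,0,0; 0,0,0,3,0,0; 0,0,0,0,0,0; 0,0,0,0,0,1; 0,0,0,0,0,0]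

noncomputable def Ym : Matrix (Fin 6) (Fin 6) ℂ :=
  !![0,0,0,0,0,0; 3,0,0,0,0,0; 0,2,0,0,0,0; 0,0,1,0,0,0; 0,0,0,0,0,0; 0,0,0,0,1,0]

noncomputable def E0 : Matrix (Fin 6) (Fin 6) ℂ :=
  !![0,0,0,0,0,0; 0,0,0,0,0,0; 0,0,0,0,0,0; 0,0,0,0,0,0; 0,0,0,0,0,0; 1,0,0,0,0,0]

noncomputable def E1 : Matrix (Fin 6) (Fin 6) ℂ :=
  !![0,0,0,0,0,0; 0,0,0,0,0,0; 0,0,0,0,0,0; 0,0,0,0,0,0; 1,0,0,0,0,0; 0,-1,0,0,0,0]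

noncomputable def E2 : Matrix (Fin 6) (Fin 6) ℂ :=
  !![0,0,0,0,0,0; 0,0,0,0,0,0; 0,0,0,0,0,0; 0,0,0,0,0,0; 0,-1,0,0,0,0; 0,0,1,0,0,0]

noncomputable def E3 : Matrix (Fin 6) (Fin 6) ℂ :=
  !![0,0,0,0,0,0; 0,0,0,0,0,0; 0,0,0,0,0,0; 0,0,0,0,0,0; 0,0,1,0,0,0; 0,0,0,-1,0,0]

noncomputable def E4 : Matrix (Fin 6) (Fin 6) ℂ :=
  !![0,0,0,0,0,0; 0,0,0,0,0,0; 0,0,0,0,0,0; 0,0,0,0,0,0; 0,0,0,-1,0,0; 0,0,0,0,0,0]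

theorem lie_Xm_E0 : ⁅Xm, E0⁆ = E1 := by
  ext i j; fin_cases i <;> fin_cases j <;>
    simp [Ring.lie_def, Xm, E0, E1]

theorem lie_Xm_E1 : ⁅Xm, E1⁆ = (2 : ℂ) • E2 := by
  ext i j; fin_cases i <;> fin_cases j <;>
    norm_num [Ring.lie_def, Xm, E1, E2, Matrix.mul_apply, Fin.sum_univ_six]

theorem lie_Xm_E2 : ⁅Xm, E2⁆ = (3 : ℂ) • E3 := by
  ext i j; fin_cases i <;> fin_cases j <;>
    norm_num [Ring.lie_def, Xm, E2, E3, Matrix.mul_apply, Fin.sum_univ_six]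

theorem lie_Xm_E3 : ⁅Xm, E3⁆ = (4 : ℂ) • E4 := by
  ext i j; fin_cases i <;> fin_cases j <;>
    norm_num [Ring.lie_def, Xm, E3, E4, Matrix.mul_apply, Fin.sum_univ_six]

theorem lie_Xm_E4 : ⁅Xm, E4⁆ = 0 := by
  ext i j; fin_cases i <;> fin_cases j <;>
    simp [Ring.lie_def, Xm, E4]

theorem lie_Ym_E4 : ⁅Ym, E4⁆ = E3 := by
  ext i j; fin_cases i <;> fin_cases j <;>
    simp [Ring.lie_def, Ym, E3, E4]

theorem lie_Ym_E3 : ⁅Ym, E3⁆ = (2 : ℂ) • E2 := by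
  ext i j; fin_cases i <;> fin_cases j <;>
    norm_num [Ring.lie_def, Ym, E2, E3, Matrix.mul_apply, Fin.sum_univ_six]

theorem lie_Ym_E2 : ⁅Ym, E2⁆ = (3 : ℂ) • E1 := by
  ext i j; fin_cases i <;> fin_cases j <;>
    norm_num [Ring.lie_def, Ym, E1, E2, Matrix.mul_apply, Fin.sum_univ_six]

theorem lie_Ym_E1 : ⁅Ym, E1⁆ = (4 : ℂ) • E0 := by
  ext i j; fin_cases i <;> fin_cases j <;>
    norm_num [Ring.lie_def, Ym, E0, E1, Matrix.mul_apply, Fin.sum_univ_six]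

theorem lie_Xm_combination (a b c d e : ℂ) :
    ⁅Xm, a • E0 + b • E1 + c • E2 + d • E3 + e • E4⁆ =
      (0 : ℂ) • E0 + a • E1 + (2 * b) • E2 + (3 * c) • E3 + (4 * d) • E4 := by
  have lie_Xm_add (A B : Matrix (Fin 6) (Fin 6) ℂ) : ⁅Xm, A + B⁆ = ⁅Xm, A⁆ + ⁅Xm, B⁆ := by
    simp only [Ring.lie_def]
    noncomm_ring
  have lie_Xm_smul (t : ℂ) (A : Matrix (Fin 6) (Fin 6) ℂ) : ⁅Xm, t • A⁆ = t • ⁅Xm, A⁆ := by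
    simp only [Ring.lie_def, Matrix.mul_smul, Matrix.smul_mul, smul_sub]
  simp only [lie_Xm_add, lie_Xm_smul, lie_Xm_E0, lie_Xm_E1, lie_Xm_E2, lie_Xm_E3, lie_Xm_E4]
  module

/-- A subspace stable under the raising operator that contains a nonzero combination of the
weight vectors contains the highest one. -/
theorem E4_mem_of_combination_mem {W : Submodule ℂ (Matrix (Fin 6) (Fin 6) ℂ)}
    (hWX : ∀ w ∈ W, ⁅Xm, w⁆ ∈ W) {a b c d e : ℂ}
    (hw : a • E0 + b • E1 + c • E2 + d • E3 + e • E4 ∈ W)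
    (hne : a • E0 + b • E1 + c • E2 + d • E3 + e • E4 ≠ 0) : E4 ∈ W := by
  have h₁ := hWX _ hw
  rw [lie_Xm_combination] at h₁
  have h₂ := hWX _ h₁
  rw [lie_Xm_combination] at h₂
  have h₃ := hWX _ h₂
  rw [lie_Xm_combination] at h₃
  have h₄ := hWX _ h₃
  rw [lie_Xm_combination] at h₄
  by_cases ha : a = 0
  · by_cases hb : b = 0
    · by_cases hc : c = 0
      · by_cases hd : d = 0
        · have he : e ≠ 0 := by
            rintro rfl
            simp [ha, hb, hc, hd] at hne
          simpa [ha, hb, hc, hd, W.smul_mem_iff he] using hw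
        · simpa [ha, hb, hc, W.smul_mem_iff (show 4 * d ≠ 0 by simpa using hd)] using h₁
      · simpa [ha, hb, W.smul_mem_iff (show 4 * (3 * c) ≠ 0 by simpa using hc)] using h₂
    · simpa [ha, W.smul_mem_iff (show 4 * (3 * (2 * b)) ≠ 0 by simpa using hb)] using h₃
  · simpa [W.smul_mem_iff (show 4 * (3 * (2 * a)) ≠ 0 by simpa using ha)] using h₄

/-- A subspace stable under the lowering operator that contains the highest weight vector
contains all the weight vectors. -/
theorem span_le_of_E4_mem {W : Submodule ℂ (Matrix (Fin 6) (Fin 6) ℂ)}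
    (hWY : ∀ w ∈ W, ⁅Ym, w⁆ ∈ W) (h₄ : E4 ∈ W) :
    Submodule.span ℂ {E0, E1, E2, E3, E4} ≤ W := by
  have h₃ : E3 ∈ W := lie_Ym_E4 ▸ hWY _ h₄
  have h₂ : E2 ∈ W := (W.smul_mem_iff two_ne_zero).1 (lie_Ym_E3 ▸ hWY _ h₃)
  have h₁ : E1 ∈ W := (W.smul_mem_iff three_ne_zero).1 (lie_Ym_E2 ▸ hWY _ h₂)
  have h₀ : E0 ∈ W := (W.smul_mem_iff (show (4 : ℂ) ≠ 0 by norm_num)).1 (lie_Ym_E1 ▸ hWY _ h₁)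
  rw [Submodule.span_le]
  rintro x (rfl | rfl | rfl | rfl | rfl) <;> assumption

/-- The span `V` of `{E₀, …, E₄}` has no nontrivial subspace invariant under the adjoint
action of both `X` and `Y`. -/
theorem stmt_4 (W : Submodule ℂ (Matrix (Fin 6) (Fin 6) ℂ))
    (hWV : W ≤ Submodule.span ℂ {E0, E1, E2, E3, E4})
    (hWX : ∀ w ∈ W, ⁅Xm, w⁆ ∈ W) (hWY : ∀ w ∈ W, ⁅Ym, w⁆ ∈ W) :
    W = ⊥ ∨ W = Submodule.span ℂ {E0, E1, E2, E3, E4} := by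
  refine or_iff_not_imp_left.2 fun hW => le_antisymm hWV ?_
  obtain ⟨w, hw, hne⟩ := W.exists_mem_ne_zero_of_ne_bot hW
  have hspan := hWV hw
  simp only [Submodule.mem_span_insert, Submodule.mem_span_singleton] at hspan
  obtain ⟨a, _, ⟨b, _, ⟨c, _, ⟨d, _, ⟨e, rfl⟩, rfl⟩, rfl⟩, rfl⟩, rfl⟩ := hspan
  simp only [← add_assoc] at hw hne
  exact span_le_of_E4_mem hWY (E4_mem_of_combination_mem hWX hw hne)
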